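/- If c is a fully invariant congruence on the free monoid M = FreeMonoid ℕ with c ≠ ⊥ which is both a modular and an upper-modular element of the lattice L of fully invariant congruences on M, then c = ⊤ or c = θ_SL. (Dual rendering of: a proper monoid variety that is a modular and lower-modular element of 𝕄𝕆ℕ equals T or SL.) -/

import Mathlib

/-- The free monoid over a countably infinite alphabet. -/
abbrev M : Type := FreeMonoid ℕ

/-- A congruence on the free monoid is fully invariant if it is stable under
all endomorphisms of the free monoid. -/
def FullyInvariant (c : Con M) : Prop :=
  ∀ f : M →* M, ∀ u v : M, c u v → c (f u) (f v)

/-- The least fully invariant congruence containing a given set of pairs. -/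
def fiClosure (S : Set (M × M)) : Con M :=
  sInf {c : Con M | FullyInvariant c ∧ ∀ p ∈ S, c p.1 p.2}

def x : M := FreeMonoid.of 0
def y : M := FreeMonoid.of 1

/-- `θ_SL`, the least fully invariant congruence containing the pairs
`(x*x, x)` and `(x*y, y*x)`. -/
def thetaSL : Con M := fiClosure {(x * x, x), (x * y, y * x)}

/-- `c` is a modular element of the lattice of fully invariant congruences. -/
def IsModularElem (c : Con M) : Prop :=
  ∀ b d : Con M, FullyInvariant b → FullyInvariant d → b ≤ d →
    (c ⊔ b) ⊓ d = (c ⊓ d) ⊔ b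

/-- `c` is an upper-modular element of the lattice of fully invariant congruences. -/
def IsUpperModularElem (c : Con M) : Prop :=
  ∀ b d : Con M, FullyInvariant b → FullyInvariant d → b ≤ c →
    c ⊓ (b ⊔ d) = b ⊔ (c ⊓ d)

open FreeMonoid (of)

/-- The number of occurrences of the letter `a` in the word `s`. -/
def occ (a : ℕ) (s : M) : ℕ := s.toList.count a

/-- The first letter of a word, if there is one. -/
def firstLetter (s : M) : Option ℕ := s.toList.head?

@[simp] theorem occ_one (a : ℕ) : occ a 1 = 0 := rfl

@[simp] theorem occ_mul (a : ℕ) (s t : M) : occ a (s * t) = occ a s + occ a t := by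
  simp [occ]

@[simp] theorem occ_of (a b : ℕ) : occ a (of b) = if b = a then 1 else 0 := by
  simp [occ, List.count_singleton]

@[simp] theorem occ_pow (a n : ℕ) (s : M) : occ a (s ^ n) = n * occ a s := by
  induction n with
  | zero => simp
  | succ n ih => rw [pow_succ, occ_mul, ih]; ring

theorem length_pow (n : ℕ) (s : M) : (s ^ n).length = n * s.length := by
  induction n with
  | zero => simp
  | succ n ih => rw [pow_succ, FreeMonoid.length_mul, ih]; ring

theorem firstLetter_mul (s t : M) :
    firstLetter (s * t) = (firstLetter s).or (firstLetter t) := by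
  simp [firstLetter]

@[simp] theorem firstLetter_one : firstLetter 1 = none := rfl

@[simp] theorem firstLetter_of (a : ℕ) : firstLetter (of a) = some a := rfl

theorem firstLetter_eq_none {s : M} : firstLetter s = none ↔ s = 1 := by
  simp [firstLetter, ← FreeMonoid.length_eq_zero, FreeMonoid.length]

theorem occ_pos_of_firstLetter {a : ℕ} {s : M} (h : firstLetter s = some a) : 0 < occ a s := by
  rw [occ, List.count_pos_iff]
  exact List.mem_of_mem_head? h

theorem length_pos_of_ne_one {s : M} (h : s ≠ 1) : 1 ≤ s.length :=
  Nat.one_le_iff_ne_zero.2 fun h0 => h (FreeMonoid.length_eq_zero.1 h0)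

/-- The endomorphism sending the letter `a` to `x` and erasing all other letters. -/
def keepLetter (a : ℕ) : M →* M := FreeMonoid.lift fun i => if i = a then x else 1

theorem keepLetter_apply (a : ℕ) (s : M) : keepLetter a s = x ^ occ a s := by
  induction s using FreeMonoid.inductionOn' with
  | one => simp
  | of_mul i s ih =>
    rw [map_mul, ih]
    by_cases hi : i = a <;> simp [keepLetter, hi, pow_add]

/-! ### Fully invariant congruences and saturated sets -/

/-- The largest fully invariant congruence saturating the set `P`. -/
def saturating (P : Set M) : Con M where
  r u v := ∀ (f : M →* M) (p q : M), p * f u * q ∈ P ↔ p * f v * q ∈ P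
  iseqv := ⟨fun _ _ _ _ => Iff.rfl, fun h f p q => (h f p q).symm,
    fun h k f p q => (h f p q).trans (k f p q)⟩
  mul' := by
    intro a b c d hab hcd f p q
    have h1 := hab f p (f c * q)
    have h2 := hcd f (p * f b) q
    simp only [map_mul, mul_assoc] at h1 h2 ⊢
    exact h1.trans h2

theorem mem_iff_of_saturating {P : Set M} {u v : M} (h : saturating P u v) : u ∈ P ↔ v ∈ P := by
  simpa using h (MonoidHom.id M) 1 1

theorem fullyInvariant_saturating (P : Set M) : FullyInvariant (saturating P) :=
  fun g _ _ h f p q => h (f.comp g) p q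

theorem FullyInvariant.inf {c d : Con M} (hc : FullyInvariant c) (hd : FullyInvariant d) :
    FullyInvariant (c ⊓ d) :=
  fun f u v h => ⟨hc f u v h.1, hd f u v h.2⟩

theorem FullyInvariant.le_saturating {c : Con M} (hc : FullyInvariant c) {P : Set M}
    (h : ∀ u v, c u v → u ∈ P → v ∈ P) : c ≤ saturating P := by
  intro u v huv f p q
  have key : ∀ s t, c s t → c (p * f s * q) (p * f t * q) := fun s t hst =>
    c.mul (c.mul (c.refl p) (hc f s t hst)) (c.refl q)
  exact ⟨h _ _ (key u v huv), h _ _ (key v u (c.symm huv))⟩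

theorem fullyInvariant_fiClosure (S : Set (M × M)) : FullyInvariant (fiClosure S) := by
  intro f u v h d hd
  exact hd.1 f u v (h d hd)

theorem fiClosure_le {S : Set (M × M)} {c : Con M} (hc : FullyInvariant c)
    (h : ∀ p ∈ S, c p.1 p.2) : fiClosure S ≤ c :=
  sInf_le ⟨hc, h⟩

theorem fiClosure_of_mem {S : Set (M × M)} {u v : M} (h : (u, v) ∈ S) : fiClosure S u v :=
  fun _ hd => hd.2 _ h

theorem fiClosure_mono {S T : Set (M × M)} (h : S ⊆ T) : fiClosure S ≤ fiClosure T :=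
  fiClosure_le (fullyInvariant_fiClosure T) fun _ hp => fiClosure_of_mem (h hp)

/-- Endomorphisms which agree up to `c` on letters agree up to `c` on all words. -/
theorem Con.rel_map_of_letters {c : Con M} {f g : M →* M} (h : ∀ i, c (f (of i)) (g (of i)))
    (s : M) : c (f s) (g s) := by
  induction s using FreeMonoid.inductionOn' with
  | one => simpa using c.refl 1
  | of_mul i s ih => simpa using c.mul (h i) ih

/-- The endomorphism sending every letter `x` to `x ^ k`. -/
def letterPow (k : ℕ) : M →* M := FreeMonoid.lift fun i => of i ^ k

@[simp] theorem letterPow_of (k i : ℕ) : letterPow k (of i) = of i ^ k := rfl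

theorem FullyInvariant.rel_pow {c : Con M} (hc : FullyInvariant c) {m n : ℕ}
    (h : c (x ^ m) (x ^ n)) (s : M) : c (s ^ m) (s ^ n) := by
  simpa [x] using hc (FreeMonoid.lift fun _ => s) _ _ h

theorem FullyInvariant.rel_letterPow {c : Con M} (hc : FullyInvariant c) {k : ℕ}
    (h : c (x ^ 1) (x ^ k)) (s : M) : c s (letterPow k s) :=
  Con.rel_map_of_letters (f := MonoidHom.id M) (g := letterPow k)
    (fun i => by simpa using hc.rel_pow h (of i)) s

theorem FullyInvariant.rel_pow_add_mul {c : Con M} (hc : FullyInvariant c) {n m : ℕ}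
    (h : c (x ^ n) (x ^ (n + m))) (k : ℕ) (s : M) : c (s ^ n) (s ^ (n + k * m)) := by
  induction k with
  | zero => simpa using c.refl (s ^ n)
  | succ k ih =>
    refine c.trans ih ?_
    have := c.mul (hc.rel_pow h s) (c.refl (s ^ (k * m)))
    rw [← pow_add, ← pow_add] at this
    convert this using 2
    ring

/-- If `u₁` and `u₂` are related to `u` and `v` by a modular element `c`, but the pair `(u₁, u₂)`
does not act on `{u, v}` and the pair `(u, v)` preserves it, then `c` relates `u` and `v`. -/
theorem IsModularElem.rel {c : Con M} (hmod : IsModularElem c) (hc : FullyInvariant c)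
    {u v u₁ u₂ : M} (hu : c u u₁) (hv : c v u₂)
    (h₁ : ∀ (f : M →* M) (p q : M), p * f u₁ * q ∈ ({u, v} : Set M) → f u₁ = f u₂)
    (h₂ : ∀ (f : M →* M) (p q : M), p * f u₂ * q ∈ ({u, v} : Set M) → f u₁ = f u₂)
    (h : ∀ (f : M →* M) (p q : M), p * f u * q ∈ ({u, v} : Set M) ↔
      p * f v * q ∈ ({u, v} : Set M)) : c u v := by
  by_contra hn
  set b := fiClosure {(u₁, u₂)}
  set d := fiClosure {(u₁, u₂), (u, v)}
  have hbi : FullyInvariant b := fullyInvariant_fiClosure _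
  have hdi : FullyInvariant d := fullyInvariant_fiClosure _
  have hduv : d u v := fiClosure_of_mem (by simp)
  have heq := hmod b d hbi hdi (fiClosure_mono (by simp))
  have hmem : ((c ⊔ b) ⊓ d) u v := by
    refine ⟨?_, hduv⟩
    have hb12 : b u₁ u₂ := fiClosure_of_mem (by simp)
    exact (c ⊔ b).trans ((le_sup_left : c ≤ c ⊔ b) hu)
      ((c ⊔ b).trans ((le_sup_right : b ≤ c ⊔ b) hb12)
        ((c ⊔ b).symm ((le_sup_left : c ≤ c ⊔ b) hv)))
  rw [heq] at hmem
  have hds : d ≤ saturating {u, v} := by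
    refine fiClosure_le (fullyInvariant_saturating _) ?_
    rintro _ (rfl | rfl) f p q
    · exact ⟨fun hm => h₁ f p q hm ▸ hm, fun hm => (h₂ f p q hm).symm ▸ hm⟩
    · exact h f p q
  have hbs : b ≤ saturating {u} := by
    refine fiClosure_le (fullyInvariant_saturating _) ?_
    rintro _ rfl f p q
    exact ⟨fun hm => h₁ f p q (Or.inl hm) ▸ hm, fun hm => (h₂ f p q (Or.inl hm)).symm ▸ hm⟩
  have hcd : c ⊓ d ≤ saturating {u} := by
    refine (hc.inf hdi).le_saturating ?_
    rintro s t ⟨hcst, hdst⟩ rfl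
    rcases (mem_iff_of_saturating (hds hdst)).1 (Or.inl rfl) with ht | rfl
    · exact ht
    · exact absurd hcst hn
  have := (mem_iff_of_saturating ((sup_le hcd hbs) hmem)).1 rfl
  rw [Set.mem_singleton_iff] at this
  exact hn (this ▸ c.refl v)

theorem firstLetter_eq_of_fiClosure {s t : M} (h : fiClosure {(x, x ^ 2)} s t) :
    firstLetter s = firstLetter t := by
  have key : ∀ a, fiClosure {(x, x ^ 2)} ≤ saturating {s | firstLetter s = a} := by
    intro a
    refine fiClosure_le (fullyInvariant_saturating _) ?_
    rintro _ rfl f p q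
    simp only [Set.mem_ofPred_eq, pow_two, map_mul, firstLetter_mul]
    cases firstLetter p <;> cases firstLetter (f x) <;> simp
  exact ((mem_iff_of_saturating (key _ h)).1 rfl).symm

/-- Application of upper-modularity to the congruence generated by `(x, x ^ 2)`. -/
theorem IsUpperModularElem.mem_iff {c : Con M} (hum : IsUpperModularElem c)
    (hc : FullyInvariant c) {u v : M} (huv : c u v) {g : M →* M}
    (hg : ∀ i, g (of i) = of i ∨ g (of i) = of i ^ 2) {P : Set M}
    (hP : ∀ s t, c s t → firstLetter s = firstLetter t → s ∈ P → t ∈ P)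
    (hgP : ∀ (f : M →* M) (p q : M), p * f (g u) * q ∈ P ↔ p * f (g v) * q ∈ P) :
    u ∈ P ↔ v ∈ P := by
  set b := fiClosure {(g u, g v)}
  set d := fiClosure {(x, x ^ 2)}
  have hbi : FullyInvariant b := fullyInvariant_fiClosure _
  have hdi : FullyInvariant d := fullyInvariant_fiClosure _
  have hbc : b ≤ c := fiClosure_le hc (by rintro _ rfl; exact hc g u v huv)
  have hx : d (x ^ 1) (x ^ 2) := by simpa using fiClosure_of_mem (S := {(x, x ^ 2)}) rfl
  have hdg : ∀ s, d s (g s) := Con.rel_map_of_letters (f := MonoidHom.id M) fun i => by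
    rcases hg i with h | h
    · simpa [h] using d.refl (of i)
    · simpa [h] using hdi.rel_pow hx (of i)
  have hmem : (c ⊓ (b ⊔ d)) u v := by
    refine ⟨huv, ?_⟩
    have hbg : b (g u) (g v) := fiClosure_of_mem (by simp)
    exact (b ⊔ d).trans ((le_sup_right : d ≤ b ⊔ d) (hdg u))
      ((b ⊔ d).trans ((le_sup_left : b ≤ b ⊔ d) hbg)
        ((b ⊔ d).symm ((le_sup_right : d ≤ b ⊔ d) (hdg v))))
  rw [hum b d hbi hdi hbc] at hmem
  refine mem_iff_of_saturating ((sup_le ?_ ?_ : b ⊔ c ⊓ d ≤ saturating P) hmem)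
  · refine fiClosure_le (fullyInvariant_saturating _) ?_
    rintro _ rfl
    exact hgP
  · exact (hc.inf hdi).le_saturating fun s t h => hP s t h.1
      (firstLetter_eq_of_fiClosure h.2)

/-! ### Words in two letters -/

/-- The set of words in the letters `x` and `y`. -/
def xyWords : Submonoid M := Submonoid.closure {x, y}

theorem x_mem_xyWords : x ∈ xyWords := Submonoid.subset_closure (by simp)

theorem y_mem_xyWords : y ∈ xyWords := Submonoid.subset_closure (by simp)

theorem length_map_of_mem_xyWords {s : M} (hs : s ∈ xyWords) (f : M →* M) :
    (f s).length = occ 0 s * (f x).length + occ 1 s * (f y).length := by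
  induction hs using Submonoid.closure_induction with
  | mem s hs => rcases hs with rfl | rfl <;> simp [x, y]
  | one => simp
  | mul s t _ _ ihs iht =>
    rw [map_mul, FreeMonoid.length_mul, ihs, iht, occ_mul, occ_mul]
    ring

theorem length_of_mem_xyWords {s : M} (hs : s ∈ xyWords) : s.length = occ 0 s + occ 1 s := by
  simpa [x, y] using length_map_of_mem_xyWords hs (MonoidHom.id M)

theorem map_eq_self_of_mem_xyWords {s : M} (hs : s ∈ xyWords) {f : M →* M} (hx : f x = x)
    (hy : f y = y) : f s = s := by
  have : Set.EqOn f (MonoidHom.id M) xyWords :=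
    MonoidHom.eqOn_closureM (by rintro _ (rfl | rfl) <;> simpa)
  exact this hs

theorem map_eq_pow_of_mem_xyWords {s : M} (hs : s ∈ xyWords) {f : M →* M}
    (h : f x = 1 ∨ f y = 1) : f s = f x ^ occ 0 s * f y ^ occ 1 s := by
  induction hs using Submonoid.closure_induction with
  | mem s hs => rcases hs with rfl | rfl <;> simp [x, y]
  | one => simp
  | mul s t _ _ ihs iht =>
    rw [map_mul, ihs, iht, occ_mul, occ_mul]
    rcases h with h | h <;> simp [h, pow_add]

/-- Words in two letters with the same letter counts cannot be separated by a homomorphism which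
erases one of the letters. -/
theorem map_eq_map_of_occ_eq {s t : M} (hs : s ∈ xyWords) (ht : t ∈ xyWords)
    (h0 : occ 0 s = occ 0 t) (h1 : occ 1 s = occ 1 t) {f : M →* M} (h : f x = 1 ∨ f y = 1) :
    f s = f t := by
  rw [map_eq_pow_of_mem_xyWords hs h, map_eq_pow_of_mem_xyWords ht h, h0, h1]

/-- A homomorphism which erases neither of two letters and maps a word in these letters into a
word which is not longer maps letters to letters. -/
theorem exists_of_of_length_le {s p q : M} {f : M →* M} (hs : s ∈ xyWords) (hx : f x ≠ 1)
    (hy : f y ≠ 1) (h0 : 1 ≤ occ 0 s) (h1 : 1 ≤ occ 1 s)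
    (h : (p * f s * q).length ≤ s.length) :
    p = 1 ∧ q = 1 ∧ (∃ a, f x = of a) ∧ (∃ b, f y = of b) := by
  rw [FreeMonoid.length_mul, FreeMonoid.length_mul, length_map_of_mem_xyWords hs,
    length_of_mem_xyWords hs] at h
  obtain ⟨i, hi⟩ := Nat.exists_eq_add_of_le (length_pos_of_ne_one hx)
  obtain ⟨j, hj⟩ := Nat.exists_eq_add_of_le (length_pos_of_ne_one hy)
  rw [← FreeMonoid.length_eq_zero, ← FreeMonoid.length_eq_zero, ← FreeMonoid.length_eq_one,
    ← FreeMonoid.length_eq_one]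
  rw [hi, hj] at h ⊢
  have hi' : i ≤ occ 0 s * i := Nat.le_mul_of_pos_left i h0
  have hj' : j ≤ occ 1 s * j := Nat.le_mul_of_pos_left j h1
  rw [mul_add, mul_add] at h
  omega

/-- A homomorphism mapping a word in two letters into a shorter word erases one of the letters. -/
theorem eq_one_or_eq_one_of_length_lt {s p q : M} {f : M →* M} (hs : s ∈ xyWords)
    (h : (p * f s * q).length < s.length) : f x = 1 ∨ f y = 1 := by
  by_contra! hn
  rw [FreeMonoid.length_mul, FreeMonoid.length_mul, length_map_of_mem_xyWords hs,
    length_of_mem_xyWords hs] at h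
  have hi := Nat.le_mul_of_pos_right (occ 0 s) (length_pos_of_ne_one hn.1)
  have hj := Nat.le_mul_of_pos_right (occ 1 s) (length_pos_of_ne_one hn.2)
  omega

theorem of_mul_inj {a b : ℕ} {s t : M} : of a * s = of b * t ↔ a = b ∧ s = t := by
  constructor
  · intro h
    exact List.cons_eq_cons.1 h
  · rintro ⟨rfl, rfl⟩
    rfl

theorem of_pow_mul_eq {a b n : ℕ} {s t : M}
    (h : of a ^ (n + 1) * (of b * s) = x ^ (n + 1) * (y * t)) :
    a = 0 ∧ b = 1 ∧ s = t := by
  obtain ⟨rfl, h'⟩ := of_mul_inj.1 (by simpa [pow_succ', mul_assoc, x] using h)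
  exact ⟨rfl, of_mul_inj.1 (mul_left_cancel h')⟩

theorem of_pow_mul_ne {a b n : ℕ} {s t : M} :
    of a ^ (n + 2) * (of b * s) ≠ y * (x ^ (n + 2) * t) := by
  intro h
  rw [pow_succ', pow_succ', pow_succ', x, y] at h
  simp only [mul_assoc, of_mul_inj] at h
  omega

theorem of_mul_pow_eq {a b n : ℕ} {s t : M}
    (h : of b * (of a ^ (n + 1) * s) = y * (x ^ (n + 1) * t)) : a = 0 ∧ b = 1 ∧ s = t := by
  obtain ⟨hb, h⟩ := of_mul_inj.1 h
  obtain ⟨rfl, h'⟩ := of_mul_inj.1 (by simpa [pow_succ', mul_assoc, x] using h)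
  exact ⟨rfl, hb, mul_left_cancel h'⟩

theorem of_mul_pow_ne {a b n : ℕ} {s t : M} :
    of b * (of a ^ (n + 2) * s) ≠ x ^ (n + 2) * (y * t) := by
  intro h
  rw [x, pow_succ' (of 0) (n + 1), mul_assoc, of_mul_inj] at h
  obtain ⟨-, h⟩ := h
  rw [pow_succ' (of 0) n, pow_succ' (of a) (n + 1), mul_assoc, mul_assoc, of_mul_inj] at h
  obtain ⟨rfl, h⟩ := h
  rw [pow_succ, mul_assoc] at h
  have := (of_mul_inj.1 (mul_left_cancel h)).1
  omega

theorem pow_mul_mem_xyWords {n : ℕ} {w : M} (hw : w ∈ xyWords) : x ^ n * (y * w) ∈ xyWords :=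
  mul_mem (pow_mem x_mem_xyWords n) (mul_mem y_mem_xyWords hw)

theorem mul_pow_mem_xyWords {n : ℕ} {w : M} (hw : w ∈ xyWords) : y * (x ^ n * w) ∈ xyWords :=
  mul_mem y_mem_xyWords (mul_mem (pow_mem x_mem_xyWords n) hw)

/-- Substitutions cannot tell apart `xⁿyw` and `yxⁿw` inside the set of these two words. -/
theorem mem_swap_iff {n : ℕ} {w : M} (hw : w ∈ xyWords) (f : M →* M) (p q : M) :
    p * f (x ^ (n + 2) * (y * w)) * q ∈
        ({x ^ (n + 2) * (y * w), y * (x ^ (n + 2) * w)} : Set M) ↔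
      p * f (y * (x ^ (n + 2) * w)) * q ∈
        ({x ^ (n + 2) * (y * w), y * (x ^ (n + 2) * w)} : Set M) := by
  have hu := pow_mul_mem_xyWords (n := n + 2) hw
  have hv := mul_pow_mem_xyWords (n := n + 2) hw
  by_cases h : f x = 1 ∨ f y = 1
  · rw [map_eq_map_of_occ_eq hu hv (by simp [x, y]) (by simp [x, y]) h]
  rw [not_or] at h
  constructor
  · intro hm
    obtain ⟨rfl, rfl, ⟨a, ha⟩, b, hb⟩ := exists_of_of_length_le hu h.1 h.2 (by simp [x, y]; omega)
      (by simp [x, y]) (by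
        rcases hm with hm | hm <;> rw [hm]
        simp [length_pow]; omega)
    simp only [one_mul, mul_one, map_mul, map_pow, ha, hb, Set.mem_insert_iff,
      Set.mem_singleton_iff] at hm ⊢
    rcases hm with hm | hm
    · obtain ⟨rfl, rfl, hw⟩ := of_pow_mul_eq hm
      rw [hw]
      exact Or.inr rfl
    · exact absurd hm of_pow_mul_ne
  · intro hm
    obtain ⟨rfl, rfl, ⟨a, ha⟩, b, hb⟩ := exists_of_of_length_le hv h.1 h.2 (by simp [x, y]; omega)
      (by simp [x, y]) (by
        rcases hm with hm | hm <;> rw [hm]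
        simp [length_pow]; omega)
    simp only [one_mul, mul_one, map_mul, map_pow, ha, hb, Set.mem_insert_iff,
      Set.mem_singleton_iff] at hm ⊢
    rcases hm with hm | hm
    · exact absurd hm of_mul_pow_ne
    · obtain ⟨rfl, rfl, hw⟩ := of_mul_pow_eq hm
      rw [hw]
      exact Or.inl rfl

/-- An embedding of the free monoid into the monoid of words in two letters. -/
def encode : M →* M := FreeMonoid.lift fun i => x ^ i * y

theorem encode_mem_xyWords (s : M) : encode s ∈ xyWords := by
  induction s using FreeMonoid.inductionOn' with
  | one => simp
  | of_mul i s ih =>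
    rw [map_mul]
    exact mul_mem (mul_mem (pow_mem x_mem_xyWords i) y_mem_xyWords) ih

theorem pow_mul_y_inj {i j : ℕ} {s t : M} (h : x ^ i * (y * s) = x ^ j * (y * t)) :
    i = j ∧ s = t := by
  induction i generalizing j with
  | zero =>
    cases j with
    | zero => exact ⟨rfl, mul_left_cancel (mul_left_cancel h)⟩
    | succ j =>
      rw [pow_succ', pow_zero, one_mul, mul_assoc, x, y, of_mul_inj] at h
      omega
  | succ i ih =>
    cases j with
    | zero =>
      rw [pow_succ', pow_zero, one_mul, mul_assoc, x, y, of_mul_inj] at h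
      omega
    | succ j =>
      rw [pow_succ', pow_succ', mul_assoc, mul_assoc] at h
      simpa using ih (mul_left_cancel h)

theorem encode_injective : Function.Injective encode := by
  intro s
  induction s using FreeMonoid.inductionOn' with
  | one =>
    intro t h
    cases t using FreeMonoid.casesOn with
    | one => rfl
    | of_mul i t =>
      have := congrArg (occ 1) h
      simp [encode, x, y] at this
      omega
  | of_mul i s ih =>
    intro t h
    cases t using FreeMonoid.casesOn with
    | one =>
      have := congrArg (occ 1) h
      simp [encode, x, y] at this
    | of_mul j t =>
      rw [map_mul, map_mul] at h
      obtain ⟨rfl, h'⟩ := pow_mul_y_inj (s := encode s) (t := encode t)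
        (by simpa [encode, mul_assoc] using h)
      rw [ih h']

/-! ### Balanced congruences -/

/-- A modular element relating two distinct words in two letters relates two words in these letters
which have the same letter counts but start with different letters. -/
theorem IsModularElem.rel_swap_of_balanced {c : Con M} (hmod : IsModularElem c)
    (hc : FullyInvariant c) (hbal : ∀ u v, c u v → ∀ a, occ a u = occ a v) {w w' : M}
    (hw : w ∈ xyWords) (hw' : w' ∈ xyWords) (hne : w ≠ w') (hww : c w w') :
    c (x ^ 2 * (y * w)) (y * (x ^ 2 * w)) := by
  have h0 := hbal _ _ hww 0
  have h1 := hbal _ _ hww 1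
  have hu := pow_mul_mem_xyWords (n := 2) hw'
  have hv := mul_pow_mem_xyWords (n := 2) hw'
  have hlen := length_of_mem_xyWords hw
  have hlen' := length_of_mem_xyWords hw'
  refine hmod.rel hc (c.mul (c.refl _) (c.mul (c.refl _) hww))
    (c.mul (c.refl _) (c.mul (c.refl _) hww)) ?_ ?_ (mem_swap_iff (n := 0) hw)
  all_goals
    intro f p q hm
    by_cases h : f x = 1 ∨ f y = 1
    · exact map_eq_map_of_occ_eq hu hv (by simp [x, y]) (by simp [x, y]) h
    rw [not_or] at h
    exfalso
  · obtain ⟨rfl, rfl, ⟨a, ha⟩, b, hb⟩ := exists_of_of_length_le hu h.1 h.2 (by simp [x, y]; omega)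
      (by simp [x, y]) (by
        rcases hm with hm | hm <;> rw [hm] <;> simp [length_pow] <;> omega)
    simp only [one_mul, mul_one, map_mul, map_pow, ha, hb, Set.mem_insert_iff,
      Set.mem_singleton_iff] at hm
    rcases hm with hm | hm
    · obtain ⟨rfl, rfl, h⟩ := of_pow_mul_eq hm
      exact hne (h ▸ map_eq_self_of_mem_xyWords hw' ha hb)
    · exact of_pow_mul_ne hm
  · obtain ⟨rfl, rfl, ⟨a, ha⟩, b, hb⟩ := exists_of_of_length_le hv h.1 h.2 (by simp [x, y]; omega)
      (by simp [x, y]) (by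
        rcases hm with hm | hm <;> rw [hm] <;> simp [length_pow] <;> omega)
    simp only [one_mul, mul_one, map_mul, map_pow, ha, hb, Set.mem_insert_iff,
      Set.mem_singleton_iff] at hm
    rcases hm with hm | hm
    · exact of_mul_pow_ne hm
    · obtain ⟨rfl, rfl, h⟩ := of_mul_pow_eq hm
      exact hne (h ▸ map_eq_self_of_mem_xyWords hw' ha hb)

theorem letterPow_mem_xyWords {s : M} (hs : s ∈ xyWords) (k : ℕ) : letterPow k s ∈ xyWords := by
  induction hs using Submonoid.closure_induction with
  | mem s hs =>
    rcases hs with rfl | rfl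
    · exact pow_mem x_mem_xyWords k
    · exact pow_mem y_mem_xyWords k
  | one => simp
  | mul s t _ _ ihs iht => simpa using mul_mem ihs iht

theorem occ_letterPow (k a : ℕ) (s : M) : occ a (letterPow k s) = k * occ a s := by
  induction s using FreeMonoid.inductionOn' with
  | one => simp
  | of_mul i s ih => simp [ih, mul_add]

/-- An upper-modular element which preserves letter counts does not relate words in two letters
starting with different letters. -/
theorem IsUpperModularElem.firstLetter_eq_of_balanced {c : Con M} (hum : IsUpperModularElem c)
    (hc : FullyInvariant c) (hbal : ∀ u v, c u v → ∀ a, occ a u = occ a v) {u v : M}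
    (hu : u ∈ xyWords) (hv : v ∈ xyWords) (h : c u v) : firstLetter u = firstLetter v := by
  have h0 := hbal _ _ h 0
  have h1 := hbal _ _ h 1
  rcases eq_or_ne u 1 with rfl | hu1
  · have : v = 1 := by
      rw [← FreeMonoid.length_eq_zero, length_of_mem_xyWords hv, ← h0, ← h1]
      rfl
    rw [this]
  have hpos := length_pos_of_ne_one hu1
  have hlu := length_of_mem_xyWords hu
  have hbal_length : ∀ s t, c s t → s.length = t.length := fun s t hst =>
    (List.perm_iff_count.2 (hbal s t hst)).length_eq
  refine ((hum.mem_iff hc h (g := letterPow 2) (fun i => Or.inr rfl)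
    (P := {s | s.length = u.length ∧ firstLetter s = firstLetter u}) ?_ ?_).1 ⟨rfl, rfl⟩).2.symm
  · rintro s t hst hfst ⟨h1, h2⟩
    exact ⟨(hbal_length s t hst) ▸ h1, hfst ▸ h2⟩
  · intro f p q
    by_cases hf : f x = 1 ∨ f y = 1
    · rw [map_eq_map_of_occ_eq (letterPow_mem_xyWords hu 2) (letterPow_mem_xyWords hv 2)
        (by simp [occ_letterPow, h0]) (by simp [occ_letterPow, h1]) hf]
    · refine iff_of_false (fun hm => hf ?_) (fun hm => hf ?_)
      · refine eq_one_or_eq_one_of_length_lt (letterPow_mem_xyWords hu 2) (p := p) (q := q) ?_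
        rw [hm.1, length_of_mem_xyWords (letterPow_mem_xyWords hu 2), occ_letterPow, occ_letterPow]
        omega
      · refine eq_one_or_eq_one_of_length_lt (letterPow_mem_xyWords hv 2) (p := p) (q := q) ?_
        rw [hm.1, length_of_mem_xyWords (letterPow_mem_xyWords hv 2), occ_letterPow, occ_letterPow]
        omega

theorem eq_bot_of_balanced {c : Con M} (hc : FullyInvariant c) (hmod : IsModularElem c)
    (hum : IsUpperModularElem c) (hbal : ∀ u v, c u v → ∀ a, occ a u = occ a v) : c = ⊥ := by
  refine le_bot_iff.1 fun {w w'} hww => ?_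
  by_contra hne
  have hw := encode_mem_xyWords w
  have := hum.firstLetter_eq_of_balanced hc hbal (pow_mul_mem_xyWords hw)
    (mul_pow_mem_xyWords hw) (hmod.rel_swap_of_balanced hc hbal hw (encode_mem_xyWords w')
      (encode_injective.ne hne) (hc encode _ _ hww))
  simp [firstLetter_mul, pow_two, x, y] at this

/-! ### Congruences relating two powers of a letter -/

theorem IsModularElem.rel_pow_mul_comm {c : Con M} (hmod : IsModularElem c)
    (hc : FullyInvariant c) {n m : ℕ} (hm : 1 ≤ m) (h : c (x ^ (n + 2)) (x ^ (n + 2 + m))) :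
    c (x ^ (n + 2) * y) (y * x ^ (n + 2)) := by
  have hu := pow_mul_mem_xyWords (n := n + 2 + m) (one_mem xyWords)
  have hv := mul_pow_mem_xyWords (n := n + 2 + m) (one_mem xyWords)
  have hrel := hmod.rel hc (u := x ^ (n + 2) * (y * 1)) (v := y * (x ^ (n + 2) * 1))
    (c.mul h (c.refl (y * 1))) (c.mul (c.refl y) (c.mul h (c.refl 1))) ?_ ?_
    (mem_swap_iff (one_mem xyWords))
  · simpa using hrel
  all_goals
    intro f p q hm
    refine map_eq_map_of_occ_eq hu hv (by simp [x, y]) (by simp [x, y]) ?_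
  · refine eq_one_or_eq_one_of_length_lt hu (p := p) (q := q) ?_
    rcases hm with hm | hm <;> rw [hm] <;> simp [length_pow, x, y] <;> omega
  · refine eq_one_or_eq_one_of_length_lt hv (p := p) (q := q) ?_
    rcases hm with hm | hm <;> rw [hm] <;> simp [length_pow, x, y] <;> omega

theorem IsUpperModularElem.not_rel_pow_mul_comm {c : Con M} (hum : IsUpperModularElem c)
    (hc : FullyInvariant c) (hlin : ∀ u v, c u v → ∀ a, occ a u = 1 → occ a v = 1) (n : ℕ) :
    ¬ c (x ^ (n + 2) * y) (y * x ^ (n + 2)) := by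
  intro h
  let g : M →* M := FreeMonoid.lift fun i => if i = 1 then of i ^ 2 else of i
  have key := (hum.mem_iff hc h (g := g) ?_
    (P := {s | occ 1 s = 1 ∧ firstLetter s = some 1}) ?_ ?_).2
      ⟨by simp [x, y], by simp [firstLetter_mul, y]⟩
  · have := key.2
    simp [pow_succ', firstLetter_mul, mul_assoc, x, y] at this
  · intro i
    by_cases hi : i = 1 <;> simp [g, hi]
  · rintro s t hst hfst ⟨h1, h2⟩
    exact ⟨hlin s t hst 1 h1, hfst ▸ h2⟩
  · intro f p q
    have hu : g (x ^ (n + 2) * y) ∈ xyWords := by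
      simpa [g, x, y] using mul_mem (pow_mem x_mem_xyWords (n + 2)) (pow_mem y_mem_xyWords 2)
    have hv : g (y * x ^ (n + 2)) ∈ xyWords := by
      simpa [g, x, y] using mul_mem (pow_mem y_mem_xyWords 2) (pow_mem x_mem_xyWords (n + 2))
    by_cases hf : f x = 1 ∨ f y = 1
    · rw [map_eq_map_of_occ_eq hu hv (by simp [add_comm]) (by simp [add_comm]) hf]
    rw [not_or] at hf
    have hz : ∀ z, occ 1 z = (n + 2) * occ 1 (f x) + 2 * occ 1 (f y) → z ≠ 1 →
        (occ 1 (p * z * q) = 1 ∧ firstLetter (p * z * q) = some 1 ↔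
          occ 1 p + occ 1 z + occ 1 q = 1 ∧ firstLetter p = some 1) := by
      intro z hz hz1
      rw [occ_mul, occ_mul, firstLetter_mul, firstLetter_mul]
      refine and_congr_right fun h1 => ?_
      cases hp : firstLetter p with
      | some a => simp
      | none =>
        refine iff_of_false (fun h2 => ?_) (by simp)
        obtain ⟨a, ha⟩ := Option.ne_none_iff_exists'.1 (mt firstLetter_eq_none.1 hz1)
        rw [ha] at h2
        obtain rfl : a = 1 := by simpa using h2
        have := occ_pos_of_firstLetter ha
        rw [add_mul] at hz
        have := Nat.zero_le (n * occ 1 (f x))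
        rcases Nat.eq_zero_or_pos (occ 1 (f x)) with h0 | h0
        · rw [h0] at hz
          omega
        · omega
    have hocc : occ 1 (f (g (x ^ (n + 2) * y))) = (n + 2) * occ 1 (f x) + 2 * occ 1 (f y) := by
      simp [g, x, y]
    have hocc' : occ 1 (f (g (y * x ^ (n + 2)))) = (n + 2) * occ 1 (f x) + 2 * occ 1 (f y) := by
      simp [g, x, y, add_comm]
    have hne : ∀ s ∈ xyWords, 0 < occ 0 s → f s ≠ 1 := by
      intro s hs h0 h1
      have hl := length_map_of_mem_xyWords hs f
      have := Nat.mul_pos h0 (length_pos_of_ne_one hf.1)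
      rw [h1, FreeMonoid.length_one] at hl
      omega
    exact (hz _ hocc (hne _ hu (by simp [g, x, y]))).trans
      ((hocc.trans hocc'.symm) ▸ (hz _ hocc' (hne _ hv (by simp [g, x, y]))).symm)

/-! ### Congruences relating a letter to a proper power of it -/

/-- The word `xxyxyyx` evaluated at `s` and `t`. -/
def cubeFreeWord (s t : M) : M := s * (s * (t * (s * (t * (t * s)))))

theorem map_cubeFreeWord (f : M →* M) (s t : M) :
    f (cubeFreeWord s t) = cubeFreeWord (f s) (f t) := by
  simp [cubeFreeWord]

theorem cubeFreeWord_mem_xyWords {s t : M} (hs : s ∈ xyWords) (ht : t ∈ xyWords) :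
    cubeFreeWord s t ∈ xyWords :=
  mul_mem hs (mul_mem hs (mul_mem ht (mul_mem hs (mul_mem ht (mul_mem ht hs)))))

theorem occ_cubeFreeWord (a : ℕ) (s t : M) :
    occ a (cubeFreeWord s t) = 4 * occ a s + 3 * occ a t := by
  simp only [cubeFreeWord, occ_mul]
  ring

theorem length_cubeFreeWord (s t : M) :
    (cubeFreeWord s t).length = 4 * s.length + 3 * t.length := by
  simp only [cubeFreeWord, FreeMonoid.length_mul]
  ring

theorem ne_append_cube {L : List ℕ} (h : ∀ i < L.length, ∀ k < L.length, 1 ≤ k →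
      (L.drop i).take k = (L.drop (i + k)).take k →
      (L.drop i).take k = (L.drop (i + (k + k))).take k → L.length < i + 3 * k)
    {p z q : List ℕ} (hz : z ≠ []) : L ≠ p ++ (z ++ (z ++ (z ++ q))) := by
  rintro rfl
  have hpos := List.length_pos_of_ne_nil hz
  have := h p.length (by simp; omega) z.length (by simp; omega) hpos
    (by simp [← List.drop_drop]) (by simp [← List.drop_drop])
  simp at this
  omega

theorem mul_cube_notMem (p q : M) {z : M} (hz : z ≠ 1) :
    p * z ^ 3 * q ∉ ({cubeFreeWord x y, cubeFreeWord y x} : Set M) := by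
  have hz' : z.toList ≠ [] := fun h => hz (FreeMonoid.toList.injective h)
  rintro (h | h)
  · refine ne_append_cube (L := [0, 0, 1, 0, 1, 1, 0]) (by decide) (p := p.toList)
      (q := q.toList) hz' ?_
    simpa [cubeFreeWord, x, y, pow_succ] using (congrArg FreeMonoid.toList h).symm
  · refine ne_append_cube (L := [1, 1, 0, 1, 0, 0, 1]) (by decide) (p := p.toList)
      (q := q.toList) hz' ?_
    simpa [cubeFreeWord, x, y, pow_succ] using (congrArg FreeMonoid.toList h).symm

theorem cubeFreeWord_of_eq {a b a' b' : ℕ}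
    (h : cubeFreeWord (of a) (of b) = cubeFreeWord (of a') (of b')) : a = a' ∧ b = b' := by
  simp only [cubeFreeWord, of_mul_inj] at h
  exact ⟨h.1, h.2.2.1⟩

theorem mem_cubeFreeWord_iff (f : M →* M) (p q : M) :
    p * f (cubeFreeWord x y) * q ∈ ({cubeFreeWord x y, cubeFreeWord y x} : Set M) ↔
      p * f (cubeFreeWord y x) * q ∈ ({cubeFreeWord x y, cubeFreeWord y x} : Set M) := by
  have hu := cubeFreeWord_mem_xyWords x_mem_xyWords y_mem_xyWords
  have hv := cubeFreeWord_mem_xyWords y_mem_xyWords x_mem_xyWords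
  by_cases hxy : f x = f y
  · rw [map_cubeFreeWord, map_cubeFreeWord, hxy]
  by_cases hf : f x = 1 ∨ f y = 1
  · obtain ⟨z, r, r', hz, hr, hr'⟩ : ∃ z r r', z ≠ 1 ∧ f (cubeFreeWord x y) = z ^ 3 * r ∧
        f (cubeFreeWord y x) = z ^ 3 * r' := by
      rw [map_cubeFreeWord, map_cubeFreeWord]
      rcases hf with hf | hf
      · exact ⟨f y, 1, f y, fun h => hxy (hf.trans h.symm),
          by simp [hf, cubeFreeWord, pow_succ, mul_assoc],
          by simp [hf, cubeFreeWord, pow_succ, mul_assoc]⟩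
      · exact ⟨f x, f x, 1, fun h => hxy (h.trans hf.symm),
          by simp [hf, cubeFreeWord, pow_succ, mul_assoc],
          by simp [hf, cubeFreeWord, pow_succ, mul_assoc]⟩
    rw [hr, hr', ← mul_assoc, ← mul_assoc, mul_assoc _ r, mul_assoc _ r']
    exact iff_of_false (mul_cube_notMem p _ hz) (mul_cube_notMem p _ hz)
  rw [not_or] at hf
  constructor
  · intro hm
    obtain ⟨rfl, rfl, ⟨a, ha⟩, b, hb⟩ := exists_of_of_length_le hu hf.1 hf.2
      (by simp [occ_cubeFreeWord, x, y]) (by simp [occ_cubeFreeWord, x, y]) (by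
        rcases hm with hm | hm <;> rw [hm]
        simp [length_cubeFreeWord, x, y])
    simp only [one_mul, mul_one, map_cubeFreeWord, ha, hb] at hm ⊢
    rcases hm with hm | hm
    · obtain ⟨rfl, rfl⟩ := cubeFreeWord_of_eq hm
      exact Or.inr rfl
    · obtain ⟨rfl, rfl⟩ := cubeFreeWord_of_eq hm
      exact Or.inl rfl
  · intro hm
    obtain ⟨rfl, rfl, ⟨a, ha⟩, b, hb⟩ := exists_of_of_length_le hv hf.1 hf.2
      (by simp [occ_cubeFreeWord, x, y]) (by simp [occ_cubeFreeWord, x, y]) (by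
        rcases hm with hm | hm <;> rw [hm]
        simp [length_cubeFreeWord, x, y])
    simp only [one_mul, mul_one, map_cubeFreeWord, ha, hb] at hm ⊢
    rcases hm with hm | hm
    · obtain ⟨rfl, rfl⟩ := cubeFreeWord_of_eq hm
      exact Or.inr rfl
    · obtain ⟨rfl, rfl⟩ := cubeFreeWord_of_eq hm
      exact Or.inl rfl

theorem IsModularElem.rel_cubeFreeWord {c : Con M} (hmod : IsModularElem c)
    (hc : FullyInvariant c) {n : ℕ} (hn : 1 ≤ n) (h : c (x ^ 1) (x ^ (1 + n))) :
    c (cubeFreeWord x y) (cubeFreeWord y x) := by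
  have hk : c (x ^ 1) (x ^ (1 + 7 * n)) := hc.rel_pow_add_mul h 7 x
  have key : ∀ s t : M, s = x ∧ t = y ∨ s = y ∧ t = x → ∀ (f : M →* M) (p q : M),
      p * f (letterPow (1 + 7 * n) (cubeFreeWord s t)) * q ∈
        ({cubeFreeWord x y, cubeFreeWord y x} : Set M) →
      f (letterPow (1 + 7 * n) (cubeFreeWord x y)) =
        f (letterPow (1 + 7 * n) (cubeFreeWord y x)) := by
    intro s t hst f p q hm
    have hlen : (p * f (letterPow (1 + 7 * n) (cubeFreeWord s t)) * q).length = 7 := by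
      rcases hm with hm | hm <;> rw [hm] <;> simp [length_cubeFreeWord, x, y]
    have hz : ∀ z : M, (1 + 7 * n) * z.length ≤ 7 → z = 1 := by
      intro z hz
      by_contra hz1
      have := Nat.mul_le_mul (le_refl (1 + 7 * n)) (length_pos_of_ne_one hz1)
      omega
    have hxy : f x = 1 ∧ f y = 1 := by
      rcases hst with ⟨rfl, rfl⟩ | ⟨rfl, rfl⟩ <;>
      simp only [map_cubeFreeWord, x, y, letterPow_of, FreeMonoid.length_mul,
        length_cubeFreeWord, map_pow, length_pow] at hlen ⊢ <;>
      exact ⟨hz _ (by omega), hz _ (by omega)⟩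
    have h0 : f (of 0) = 1 := hxy.1
    have h1 : f (of 1) = 1 := hxy.2
    simp [map_cubeFreeWord, x, y, h0, h1]
  exact hmod.rel hc (hc.rel_letterPow hk _) (hc.rel_letterPow hk _)
    (key x y (Or.inl ⟨rfl, rfl⟩)) (key y x (Or.inr ⟨rfl, rfl⟩)) mem_cubeFreeWord_iff

theorem FullyInvariant.rel_sq {c : Con M} (hc : FullyInvariant c) {n : ℕ} (hn : 1 ≤ n)
    (h : c (x ^ 1) (x ^ (1 + n))) (hw : c (cubeFreeWord x y) (cubeFreeWord y x)) :
    c (x * x) x := by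
  have h43 : c (x ^ 4) (x ^ 3) := by
    simpa [keepLetter_apply, occ_cubeFreeWord, x, y] using hc (keepLetter 0) _ _ hw
  obtain ⟨j, hj⟩ : ∃ j, 3 * n = 3 + j := ⟨3 * n - 3, by omega⟩
  have h1 : c (x ^ 1) (x ^ (1 + 3 * n)) := hc.rel_pow_add_mul h 3 x
  have h2 : c (x ^ (1 + 3 * n)) (x ^ (3 * n)) := by
    have := c.mul h43 (c.refl (x ^ j))
    rwa [← pow_add, ← pow_add, show 4 + j = 1 + 3 * n by omega, ← hj] at this
  have h3 := c.mul (c.trans h1 h2) (c.refl x)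
  rw [← pow_succ, ← pow_succ, add_comm (3 * n)] at h3
  simpa [pow_two] using c.trans h3 (c.symm h1)

theorem thetaSL_le {c : Con M} (hc : FullyInvariant c) (hsq : c (x * x) x)
    (hw : c (cubeFreeWord x y) (cubeFreeWord y x)) : thetaSL ≤ c := by
  have hidem : ∀ s : c.Quotient, s * s = s := by
    intro s
    induction s using Con.induction_on with
    | H s => exact c.eq.2 (by simpa [x] using hc (FreeMonoid.lift fun _ => s) _ _ hsq)
  have hidem' : ∀ s t : c.Quotient, s * (s * t) = s * t := fun s t => by
    rw [← mul_assoc, hidem]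
  have hq : ((x : M) : c.Quotient) * (y * x) = y * (x * y) := by
    have h : ∀ s t : c.Quotient, s * (s * (t * (s * (t * (t * s))))) = s * (t * s) := fun s t => by
      have := hidem' (s * t) s
      simp only [mul_assoc] at this
      rw [hidem', hidem', this]
    rw [← h, ← h]
    simpa [cubeFreeWord] using c.eq.2 hw
  refine fiClosure_le hc ?_
  rintro _ (rfl | rfl)
  · exact hsq
  refine c.eq.1 ?_
  rw [Con.coe_mul, Con.coe_mul]
  have h₁ : ((x : M) : c.Quotient) * y = x * (y * x) := by
    rw [← hidem (x * y), mul_assoc, ← hq, hidem']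
  have h₂ : ((y : M) : c.Quotient) * x = x * (y * x) := by
    rw [← hidem (y * x), mul_assoc, ← mul_assoc (x : c.Quotient), ← mul_assoc (y : c.Quotient),
      ← hq, mul_assoc, mul_assoc, hidem, hidem']
  exact h₁.trans h₂.symm

theorem thetaSL_of_occ {s t : M} (h : ∀ a, 0 < occ a s ↔ 0 < occ a t) : thetaSL s t := by
  have hfi : FullyInvariant thetaSL := fullyInvariant_fiClosure _
  have hidem : ∀ s, thetaSL (s * s) s := fun s => by
    simpa [x] using hfi (FreeMonoid.lift fun _ => s) _ _ (fiClosure_of_mem (Or.inl rfl))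
  have hcomm : ∀ s t, thetaSL (s * t) (t * s) := fun s t => by
    simpa [x, y] using hfi (FreeMonoid.lift fun i => if i = 0 then s else t) _ _
      (fiClosure_of_mem (Or.inr rfl))
  have hletter : ∀ a s, 0 < occ a s → thetaSL (of a * s) s := by
    intro a s
    induction s using FreeMonoid.inductionOn' with
    | one => simp
    | of_mul i s ih =>
      intro hs
      by_cases hi : i = a
      · rw [hi, ← mul_assoc]
        exact thetaSL.mul (hidem _) (thetaSL.refl s)
      · have := thetaSL.mul (hcomm (of a) (of i)) (thetaSL.refl s)
        rw [mul_assoc, mul_assoc] at this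
        exact thetaSL.trans this (thetaSL.mul (thetaSL.refl _) (ih (by simpa [hi] using hs)))
  have habs : ∀ s t, (∀ a, 0 < occ a s → 0 < occ a t) → thetaSL (s * t) t := by
    intro s t
    induction s using FreeMonoid.inductionOn' with
    | one => exact fun _ => thetaSL.refl t
    | of_mul i s ih =>
      intro hs
      rw [mul_assoc]
      exact thetaSL.trans (thetaSL.mul (thetaSL.refl _) (ih fun a ha => hs a (by simp [ha])))
        (hletter i t (hs i (by simp)))
  exact thetaSL.trans (thetaSL.symm (habs t s fun a => (h a).2))
    (thetaSL.trans (hcomm t s) (habs s t fun a => (h a).1))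

theorem eq_top_or_eq_thetaSL {c : Con M} (hc : FullyInvariant c) (h : thetaSL ≤ c) :
    c = ⊤ ∨ c = thetaSL := by
  by_cases hocc : ∀ u v, c u v → ∀ a, 0 < occ a u → 0 < occ a v
  · exact Or.inr (le_antisymm (fun {u v} huv => thetaSL_of_occ fun a =>
      ⟨hocc u v huv a, hocc v u (c.symm huv) a⟩) h)
  push Not at hocc
  obtain ⟨u, v, huv, a, hu, hv⟩ := hocc
  obtain ⟨k, hk⟩ := Nat.exists_eq_add_of_le (Nat.succ_le_iff.2 hu)
  have h1 := hc (keepLetter a) _ _ huv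
  rw [keepLetter_apply, keepLetter_apply, Nat.le_zero.1 hv, hk] at h1
  have hsq : c (x ^ 1) (x ^ (1 + 1)) := by
    simpa [pow_two] using c.symm (h (fiClosure_of_mem (Or.inl rfl)))
  have h2 : c (x ^ 1) (x ^ 0) := c.trans (by simpa using hc.rel_pow_add_mul hsq k x) h1
  have h3 : ∀ s, c s 1 := fun s => by simpa using hc.rel_pow h2 s
  exact Or.inl (top_le_iff.1 fun {s t} _ => c.trans (h3 s) (c.symm (h3 t)))

/-- A fully invariant congruence `c ≠ ⊥` which is a modular and upper-modular
element of the lattice of fully invariant congruences equals `⊤` or `θ_SL`.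
(Dual rendering of: a proper monoid variety that is a modular and
lower-modular element of 𝕄𝕆ℕ equals T or SL.) -/
theorem proper_modular_upperModular (c : Con M) (hc : FullyInvariant c)
    (hne : c ≠ ⊥) (hmod : IsModularElem c) (hum : IsUpperModularElem c) :
    c = ⊤ ∨ c = thetaSL := by
  by_cases hI : ∃ n, 1 ≤ n ∧ c (x ^ 1) (x ^ (1 + n))
  · obtain ⟨n, hn, h⟩ := hI
    have hw := hmod.rel_cubeFreeWord hc hn h
    exact eq_top_or_eq_thetaSL hc (thetaSL_le hc (hc.rel_sq hn h hw) hw)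
  exfalso
  push Not at hI
  have hzero : ∀ m, 1 ≤ m → ¬ c (x ^ 0) (x ^ m) := fun m hm h =>
    hI m hm (by simpa only [pow_add, pow_zero, mul_one] using c.mul (c.refl (x ^ 1)) h)
  have hrel : ∀ u v, c u v → ∀ a, c (x ^ occ a u) (x ^ occ a v) := fun u v huv a => by
    simpa [keepLetter_apply] using hc (keepLetter a) _ _ huv
  have hpow : ∀ p q, p < q → ¬ c (x ^ p) (x ^ q) := by
    intro p q hpq h
    rcases p with _ | _ | n
    · exact hzero q hpq h
    · exact hI (q - 1) (by omega) (by rwa [show 1 + (q - 1) = q by omega])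
    · refine hum.not_rel_pow_mul_comm hc (fun u v huv a ha => ?_) n
        (hmod.rel_pow_mul_comm hc (m := q - (n + 2)) (by omega)
          (by rwa [show n + 2 + (q - (n + 2)) = q by omega]))
      have hq := hrel u v huv a
      rw [ha] at hq
      rcases hv : occ a v with _ | _ | k
      · rw [hv] at hq
        exact absurd (c.symm hq) (hzero 1 le_rfl)
      · rfl
      · rw [hv] at hq
        exact absurd hq
          (by simpa [add_comm, add_assoc, one_add_one_eq_two] using hI (k + 1) (by omega))
  refine hne (eq_bot_of_balanced hc hmod hum fun u v huv a => ?_)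
  rcases lt_trichotomy (occ a u) (occ a v) with h | h | h
  · exact absurd (hrel u v huv a) (hpow _ _ h)
  · exact h
  · exact absurd (c.symm (hrel u v huv a)) (hpow _ _ h)
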